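/- Let Ω be an n-connected quadrature domain of finite area with C^∞ smooth boundary. Then there exist polynomials P, Q ∈ ℂ[X,Y] such that z ↦ Q(z, conj(z)) is not identically zero on ∂Ω and such that for every continuously differentiable map γ from an open real interval into ∂Ω with nowhere-vanishing derivative, (γ'(t)/|γ'(t)|)²·Q(γ(t), conj(γ(t))) = P(γ(t), conj(γ(t))) for all t; that is, the square T(z)² of the unit tangent vector function on ∂Ω is a rational function of z and conj(z). -/

import Mathlib

open MeasureTheory Complex ComplexConjugate Metric Set

noncomputable section

/-- `f` belongs to the Bergman space `A²(Ω)`. -/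
def BergmanFun (Ω : Set ℂ) (f : ℂ → ℂ) : Prop :=
  DifferentiableOn ℂ f Ω ∧ IntegrableOn (fun z => ‖f z‖ ^ 2) Ω volume

/-- `Ω` is a finitely connected domain none of whose complementary components is a point. -/
def IsFinConnDomain (Ω : Set ℂ) : Prop :=
  IsOpen Ω ∧ IsConnected Ω ∧
  {C : Set ℂ | ∃ x ∈ Ωᶜ, C = connectedComponentIn Ωᶜ x}.Finite ∧
  ∀ x ∈ Ωᶜ, ¬ (connectedComponentIn Ωᶜ x).Subsingleton

/-- `Ω` is a quadrature domain. -/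
def IsQuadratureDomain (Ω : Set ℂ) : Prop :=
  ∃ N : ℕ, 0 < N ∧ ∃ (w : Fin N → ℂ) (n : Fin N → ℕ) (c : Fin N → ℕ → ℂ),
    (∀ j, w j ∈ Ω) ∧
    ∀ f : ℂ → ℂ, BergmanFun Ω f →
      (∫ z in Ω, f z) =
        ∑ j, ∑ k ∈ Finset.range (n j + 1), c j k * iteratedDerivWithin k f Ω (w j)

/-- `fa` is an Ahlfors map of `Ω` at `a`. -/
def IsAhlforsMap (Ω : Set ℂ) (a : ℂ) (fa : ℂ → ℂ) : Prop :=
  DifferentiableOn ℂ fa Ω ∧ (∀ z ∈ Ω, ‖fa z‖ < 1) ∧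
  (deriv fa a).im = 0 ∧ 0 < (deriv fa a).re ∧
  ∀ g : ℂ → ℂ, DifferentiableOn ℂ g Ω → (∀ z ∈ Ω, ‖g z‖ < 1) →
    ‖deriv g a‖ ≤ (deriv fa a).re

/-- `Ω` is bounded with `C^∞` smooth boundary consisting of finitely many disjoint
simple closed curves. -/
def HasSmoothBoundary (Ω : Set ℂ) : Prop :=
  Bornology.IsBounded Ω ∧
  ∃ (n : ℕ) (γ : Fin n → ℝ → ℂ),
    (∀ i, ContDiff ℝ (⊤ : ℕ∞) (γ i)) ∧
    (∀ i, Function.Periodic (γ i) (2 * Real.pi)) ∧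
    (∀ i, InjOn (γ i) (Ico 0 (2 * Real.pi))) ∧
    (∀ i t, deriv (γ i) t ≠ 0) ∧
    (Pairwise fun i j => Disjoint (range (γ i)) (range (γ j))) ∧
    frontier Ω = ⋃ i, range (γ i)

/-- Partial derivative in the `x`-direction of a real-valued function on `ℂ`. -/
def pdx (u : ℂ → ℝ) (z : ℂ) : ℝ := deriv (fun t : ℝ => u (z + (t : ℂ))) 0

/-- Partial derivative in the `y`-direction of a real-valued function on `ℂ`. -/
def pdy (u : ℂ → ℝ) (z : ℂ) : ℝ := deriv (fun t : ℝ => u (z + (t : ℂ) * Complex.I)) 0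

/-- `f` is a proper holomorphic map of `Ω` onto the open unit disc. -/
def IsProperOntoDisc (Ω : Set ℂ) (f : ℂ → ℂ) : Prop :=
  DifferentiableOn ℂ f Ω ∧ f '' Ω = ball (0 : ℂ) 1 ∧
  ∀ L : Set ℂ, L ⊆ ball (0 : ℂ) 1 → IsCompact L → IsCompact (Ω ∩ f ⁻¹' L)

/-- `g` is `(m, δ)`-close to the identity on `closure Ω`. -/
def CloseToId (Ω : Set ℂ) (m : ℕ) (δ : ℝ) (g : ℂ → ℂ) : Prop :=
  ∀ k ≤ m, ∀ z ∈ closure Ω, ‖iteratedFDeriv ℝ k (fun w => g w - w) z‖ ≤ δ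

/-- `σ : [0,1] → ℂ` is a piecewise continuously differentiable curve. -/
def PiecewiseC1On01 (σ : ℝ → ℂ) : Prop :=
  ContinuousOn σ (Icc 0 1) ∧ ∃ s : Finset ℝ, ContDiffOn ℝ 1 σ (Icc (0 : ℝ) 1 \ s)

/-- `Ω` is a generalized quadrature domain. -/
def IsGenQuadratureDomain (Ω : Set ℂ) : Prop :=
  ∃ (N M : ℕ) (w : Fin N → ℂ) (n : Fin N → ℕ) (c : Fin N → ℕ → ℂ)
    (b : Fin M → ℂ) (σ : Fin M → ℝ → ℂ),
    (∀ j, w j ∈ Ω) ∧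
    (∀ m, PiecewiseC1On01 (σ m)) ∧
    (∀ m, ∀ t ∈ Icc (0 : ℝ) 1, σ m t ∈ Ω) ∧
    ∀ f : ℂ → ℂ, BergmanFun Ω f →
      (∫ z in Ω, f z) =
        (∑ j, ∑ k ∈ Finset.range (n j + 1), c j k * iteratedDerivWithin k f Ω (w j)) +
        ∑ m, b m * ∫ t in (0 : ℝ)..1, f (σ m t) * deriv (σ m) t


section Polynomial

open MvPolynomial

/-- Chain rule for the evaluation of a real polynomial along a curve in the plane. -/
lemma hasDerivAt_eval_comp (F : MvPolynomial (Fin 2) ℝ) {u : Fin 2 → ℝ → ℝ} {u' : Fin 2 → ℝ} {t : ℝ}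
    (hu : ∀ i, HasDerivAt (u i) (u' i) t) :
    HasDerivAt (fun s => eval (fun i => u i s) F)
      (∑ i, eval (fun i => u i t) (pderiv i F) * u' i) t := by
  induction F using MvPolynomial.induction_on with
  | C a => simpa using hasDerivAt_const t a
  | add p q hp hq =>
    simp only [map_add, add_mul, Finset.sum_add_distrib]
    exact hp.add hq
  | mul_X p j hp =>
    have h := hp.mul (hu j)
    simp only [map_mul, eval_X]
    refine h.congr_deriv ?_
    fin_cases j <;> simp [pderiv_X, Pi.single_apply] <;> ring

lemma totalDegree_pderiv_lt {F : MvPolynomial (Fin 2) ℝ} {i : Fin 2} (h : pderiv i F ≠ 0) :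
    (pderiv i F).totalDegree < F.totalDegree := by
  classical
  obtain ⟨m, hm, hmd⟩ := Finset.exists_mem_eq_sup (pderiv i F).support
    (by simpa [Finset.nonempty_iff_ne_empty] using h) (fun s => s.sum fun _ e => e)
  have h1 : m + Finsupp.single i 1 ∈ F.support := by
    rw [mem_support_iff, coeff_pderiv] at hm
    rw [mem_support_iff]
    exact left_ne_zero_of_mul hm
  have h2 := le_totalDegree h1
  rw [totalDegree, hmd]
  rw [Finsupp.sum_add_index' (by simp) (by simp)] at h2
  simp only [Finsupp.sum_single_index] at h2
  omega

lemma eq_C_of_pderiv_eq_zero {F : MvPolynomial (Fin 2) ℝ} (h : ∀ i, pderiv i F = 0) :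
    F = C (coeff 0 F) := by
  classical
  ext m
  rw [coeff_C]
  split_ifs with h0
  · rw [h0]
  · obtain ⟨i, hi⟩ : ∃ i, m i ≠ 0 := by
      by_contra! hc
      exact h0 (Finsupp.ext fun i => (hc i).symm)
    have h1 := coeff_pderiv (i := i) F (m - Finsupp.single i 1)
    rw [h i, tsub_add_cancel_of_le (by simpa [Nat.one_le_iff_ne_zero] using hi)] at h1
    exact (mul_eq_zero.1 h1.symm).resolve_right (by positivity)

/-- The polynomial in `z` and `conj z` that a polynomial in the real coordinates induces. -/
def toConjPoly (F : MvPolynomial (Fin 2) ℝ) : MvPolynomial (Fin 2) ℂ :=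
  aeval ![C (1 / 2) * (X 0 + X 1), C (-I / 2) * (X 0 - X 1)] F

lemma eval_toConjPoly (F : MvPolynomial (Fin 2) ℝ) (z : ℂ) :
    eval ![z, conj z] (toConjPoly F) = (eval ![z.re, z.im] F : ℝ) := by
  induction F using MvPolynomial.induction_on with
  | C a => simp [toConjPoly, MvPolynomial.algebraMap_apply]
  | add p q hp hq => simp_all [toConjPoly]
  | mul_X p j hp =>
    have hX : eval ![z, conj z] (toConjPoly (X j)) = (eval ![z.re, z.im] (X j) : ℝ) := by
      fin_cases j
      · simp [toConjPoly, Complex.add_conj]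
      · simp only [toConjPoly, aeval_X]
        simp [Complex.sub_conj]
        linear_combination (-(z.im : ℂ)) * Complex.I_mul_I
    rw [toConjPoly, map_mul, map_mul, ← toConjPoly, ← toConjPoly, hp, hX]
    simp

/-- The square of the unit tangent is rational along any nonempty set in the zero set of
a nonzero real polynomial. -/
lemma exists_tangent_sq_rational {S : Set ℂ} (hS : S.Nonempty)
    (hF : ∃ F : MvPolynomial (Fin 2) ℝ, F ≠ 0 ∧ ∀ z ∈ S, eval ![z.re, z.im] F = 0) :
    ∃ P Q : MvPolynomial (Fin 2) ℂ,
      (∃ z ∈ S, MvPolynomial.eval ![z, conj z] Q ≠ 0) ∧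
      ∀ (a b : ℝ) (γ : ℝ → ℂ), ContDiffOn ℝ 1 γ (Ioo a b) →
        (∀ t ∈ Ioo a b, γ t ∈ S) →
        (∀ t ∈ Ioo a b, deriv γ t ≠ 0) →
        ∀ t ∈ Ioo a b,
          (deriv γ t / (‖deriv γ t‖ : ℂ)) ^ 2 *
              MvPolynomial.eval ![γ t, conj (γ t)] Q =
            MvPolynomial.eval ![γ t, conj (γ t)] P := by
  classical
  have hex : ∃ n, ∃ F : MvPolynomial (Fin 2) ℝ,
      F.totalDegree = n ∧ F ≠ 0 ∧ ∀ z ∈ S, eval ![z.re, z.im] F = 0 :=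
    hF.elim fun F h => ⟨_, F, rfl, h⟩
  obtain ⟨F, hFn, hF0, hFS⟩ := Nat.find_spec hex
  have hmin : ∀ G : MvPolynomial (Fin 2) ℝ, G.totalDegree < F.totalDegree →
      (∀ z ∈ S, eval ![z.re, z.im] G = 0) → G = 0 := by
    intro G hG hGS
    by_contra h0
    exact Nat.find_min hex (hFn ▸ hG) ⟨G, rfl, h0, hGS⟩
  have hQ : ∀ z : ℂ, eval ![z, conj z] (toConjPoly (pderiv 0 F) - C I * toConjPoly (pderiv 1 F)) =
      (eval ![z.re, z.im] (pderiv 0 F) : ℝ) - I * (eval ![z.re, z.im] (pderiv 1 F) : ℝ) := by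
    intro z
    simp only [map_sub, map_mul, eval_C, eval_toConjPoly]
  refine ⟨-(toConjPoly (pderiv 0 F) + C I * toConjPoly (pderiv 1 F)),
    toConjPoly (pderiv 0 F) - C I * toConjPoly (pderiv 1 F), ?_, ?_⟩
  · by_contra! hc
    have hzero : ∀ i, pderiv i F = 0 := by
      intro i
      by_contra hi
      refine hi (hmin _ (totalDegree_pderiv_lt hi) fun z hz => ?_)
      have h := hc z hz
      rw [hQ] at h
      have hre := congrArg Complex.re h
      have him := congrArg Complex.im h
      simp at hre him
      fin_cases i
      · simpa using hre
      · simpa using him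
    obtain ⟨z, hz⟩ := hS
    have h1 := eq_C_of_pderiv_eq_zero hzero
    have h2 := hFS z hz
    rw [h1, eval_C] at h2
    exact hF0 (by rw [h1, h2, C_0])
  · intro a b γ hγ hγS hγ' t ht
    have hd : HasDerivAt γ (deriv γ t) t :=
      ((hγ.differentiableOn one_ne_zero).differentiableAt (isOpen_Ioo.mem_nhds ht)).hasDerivAt
    have hre : HasDerivAt (fun s => (γ s).re) (deriv γ t).re t :=
      Complex.reCLM.hasFDerivAt.comp_hasDerivAt t hd
    have him : HasDerivAt (fun s => (γ s).im) (deriv γ t).im t :=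
      Complex.imCLM.hasFDerivAt.comp_hasDerivAt t hd
    have hchain := hasDerivAt_eval_comp F (u := ![fun s => (γ s).re, fun s => (γ s).im])
      (u' := ![(deriv γ t).re, (deriv γ t).im]) (t := t)
      (by intro i; fin_cases i; exacts [hre, him])
    have hvec : ∀ s, (fun i => (![fun s => (γ s).re, fun s => (γ s).im] : Fin 2 → ℝ → ℝ) i s) =
        ![(γ s).re, (γ s).im] := by
      intro s
      ext i
      fin_cases i <;> rfl
    simp only [hvec] at hchain
    have hzero : HasDerivAt (fun s => eval ![(γ s).re, (γ s).im] F) 0 t := by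
      refine (hasDerivAt_const t (0 : ℝ)).congr_of_eventuallyEq ?_
      filter_upwards [isOpen_Ioo.mem_nhds ht] with s hs using hFS _ (hγS s hs)
    have hrel := hchain.unique hzero
    simp only [Fin.sum_univ_two, Matrix.cons_val_zero, Matrix.cons_val_one] at hrel
    have hrel' := congrArg (fun x : ℝ => (x : ℂ)) hrel
    push_cast at hrel'
    have hn : ((‖deriv γ t‖ : ℝ) : ℂ) ≠ 0 := by simpa using hγ' t ht
    have hn2 : ((‖deriv γ t‖ : ℝ) : ℂ) ^ 2 = deriv γ t * conj (deriv γ t) :=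
      (Complex.mul_conj' _).symm
    rw [hQ, div_pow, div_mul_eq_mul_div, div_eq_iff (pow_ne_zero 2 hn), hn2]
    simp only [map_neg, map_add, map_mul, eval_C, eval_toConjPoly]
    set A : ℂ := ((eval ![(γ t).re, (γ t).im] (pderiv 0 F) : ℝ) : ℂ)
    set B : ℂ := ((eval ![(γ t).re, (γ t).im] (pderiv 1 F) : ℝ) : ℂ)
    have e1 : deriv γ t = (deriv γ t).re + (deriv γ t).im * I := (Complex.re_add_im _).symm
    have e2 : conj (deriv γ t) = (deriv γ t).re - (deriv γ t).im * I := by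
      apply Complex.ext <;> simp
    have key : deriv γ t * (A - I * B) + conj (deriv γ t) * (A + I * B) = 0 := by
      rw [e2]
      nth_rewrite 1 [e1]
      linear_combination 2 * hrel' - 2 * (deriv γ t).im * B * Complex.I_mul_I
    linear_combination deriv γ t * key

end Polynomial

section Division

/-- Dividing out a point at which the values of a linear family vanish. -/
def dslopeLinear {V : Type} [AddCommGroup V] [Module ℝ V] {Ω : Set ℂ} (hΩ : IsOpen Ω)
    (T : V →ₗ[ℝ] (ℂ → ℂ)) (hT : ∀ v, DiffContOnCl ℂ (T v) Ω) {w : ℂ} (hw : w ∈ Ω) :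
    V →ₗ[ℝ] (ℂ → ℂ) where
  toFun v := dslope (T v) w
  map_add' u v := by
    have hd : ∀ v, DifferentiableAt ℂ (T v) w := fun v =>
      (hT v).differentiableAt hΩ hw
    ext z
    by_cases hz : z = w
    · subst hz
      simp [dslope_same, deriv_add (hd u) (hd v)]
    · simp [dslope_of_ne _ hz, slope_def_field]
      ring
  map_smul' c v := by
    have hd : DifferentiableAt ℂ (T v) w := (hT v).differentiableAt hΩ hw
    ext z
    by_cases hz : z = w
    · subst hz
      have h : c • T v = fun x => (c : ℂ) * T v x := by
        ext x
        simp
      simp [dslope_same, h, deriv_const_mul _ hd]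
    · simp [dslope_of_ne _ hz, slope_def_field]
      ring

lemma DiffContOnCl.dslope_of_mem {Ω : Set ℂ} (hΩ : IsOpen Ω) {f : ℂ → ℂ} (hf : DiffContOnCl ℂ f Ω)
    {w : ℂ} (hw : w ∈ Ω) : DiffContOnCl ℂ (dslope f w) Ω :=
  ⟨(Complex.differentiableOn_dslope (hΩ.mem_nhds hw)).2 hf.differentiableOn,
    (continuousOn_dslope (Filter.mem_of_superset (hΩ.mem_nhds hw) subset_closure)).2
      ⟨hf.continuousOn, hf.differentiableAt hΩ hw⟩⟩

/-- A sufficiently large linear family of holomorphic functions has a nonzero member divisible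
by prescribed linear factors. -/
lemma exists_ne_zero_eq_prod_mul {Ω : Set ℂ} (hΩ : IsOpen Ω) (L : List ℂ) (hL : ∀ w ∈ L, w ∈ Ω) :
    ∀ (V : Type) [AddCommGroup V] [Module ℝ V] [FiniteDimensional ℝ V]
      (T : V →ₗ[ℝ] (ℂ → ℂ)), (∀ v, DiffContOnCl ℂ (T v) Ω) →
      2 * L.length < Module.finrank ℝ V →
      ∃ v : V, v ≠ 0 ∧ ∃ K : ℂ → ℂ, DiffContOnCl ℂ K Ω ∧
        ∀ z, T v z = (L.map fun w => z - w).prod * K z := by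
  induction L with
  | nil =>
    intro V _ _ _ T hT hV
    have : Nontrivial V := Module.finrank_pos_iff.1 (by simpa using hV)
    obtain ⟨v, hv⟩ := exists_ne (0 : V)
    exact ⟨v, hv, T v, hT v, by simp⟩
  | cons w L ih =>
    intro V _ _ _ T hT hV
    have hw : w ∈ Ω := hL w (by simp)
    set e : V →ₗ[ℝ] ℂ := (LinearMap.proj w : (ℂ → ℂ) →ₗ[ℝ] ℂ) ∘ₗ T with he
    have hrk := e.finrank_range_add_finrank_ker
    have hle : Module.finrank ℝ (LinearMap.range e) ≤ 2 := by
      simpa using Submodule.finrank_le (LinearMap.range e)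
    rw [List.length_cons] at hV
    obtain ⟨v, hv, K, hK, hvK⟩ := ih (fun x hx => hL x (by simp [hx])) (LinearMap.ker e)
      ((dslopeLinear hΩ T hT hw) ∘ₗ (LinearMap.ker e).subtype)
      (fun v => (hT v).dslope_of_mem hΩ hw) (by omega)
    refine ⟨v, by simpa using hv, K, hK, fun z => ?_⟩
    have h0 : T v w = 0 := LinearMap.mem_ker.1 v.2
    have h1 := sub_smul_dslope (T v) w z
    have h2 := hvK z
    simp only [LinearMap.comp_apply, Submodule.subtype_apply] at h2
    change dslope (T v) w z = _ at h2
    rw [h0, sub_zero, h2, smul_eq_mul] at h1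
    rw [← h1, List.map_cons, List.prod_cons, mul_assoc]

/-- A function that is holomorphic in a bounded domain, real on its boundary and zero at an
interior point vanishes on the boundary. -/
lemma eqOn_frontier_zero_of_real {Ω : Set ℂ} (hΩ : IsOpen Ω) (hc : IsPreconnected Ω)
    (hb : Bornology.IsBounded Ω) {K : ℂ → ℂ} (hK : DiffContOnCl ℂ K Ω) {z₀ : ℂ} (hz₀ : z₀ ∈ Ω)
    (h0 : K z₀ = 0) (hr : ∀ z ∈ frontier Ω, (K z).im = 0) : ∀ z ∈ frontier Ω, K z = 0 := by
  have hexp : ∀ c : ℝ, EqOn (fun z => Complex.exp (Complex.I * c * K z)) (fun _ => 1)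
      (closure Ω) := by
    intro c
    have hd : DiffContOnCl ℂ (fun z => Complex.exp (Complex.I * c * K z)) Ω :=
      ⟨((hK.differentiableOn.const_mul _).cexp), (continuousOn_const.mul hK.continuousOn).cexp⟩
    have hle : ∀ z ∈ closure Ω, ‖Complex.exp (Complex.I * c * K z)‖ ≤ 1 := fun z hz =>
      Complex.norm_le_of_forall_mem_frontier_norm_le hb hd
        (fun x hx => by simp [Complex.norm_exp, hr x hx]) hz
    have := Complex.eqOn_closure_of_isPreconnected_of_isMaxOn_norm hc hΩ hd hz₀
      (fun z hz => by simpa [h0] using hle z (subset_closure hz))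
    simpa [h0, Function.const_def] using this
  intro z hz
  by_contra hne
  have hre : K z = (K z).re := by apply Complex.ext <;> simp [hr z hz]
  have hre0 : (K z).re ≠ 0 := by
    intro h
    rw [h] at hre
    exact hne (by simpa using hre)
  have h := hexp (Real.pi / (K z).re) (frontier_subset_closure hz)
  simp only at h
  rw [hre] at h
  have h2 : Complex.I * ((Real.pi / (K z).re : ℝ) : ℂ) * ((K z).re : ℂ) = Real.pi * Complex.I := by
    have : ((K z).re : ℂ) ≠ 0 := by exact_mod_cast hre0
    push_cast
    field_simp
  rw [Complex.ofReal_re, h2, Complex.exp_pi_mul_I] at h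
  norm_num at h

end Division

section Algebraic

open MvPolynomial

/-- The real polynomial in two variables with bidegrees below `d + 1` and given coefficients. -/
def ofCoeffs {d : ℕ} (r : Fin (d + 1) × Fin (d + 1) → ℝ) : MvPolynomial (Fin 2) ℝ :=
  ∑ p, C (r p) * (X 0 ^ (p.1 : ℕ) * X 1 ^ (p.2 : ℕ))

lemma ofCoeffs_ne_zero {d : ℕ} {r : Fin (d + 1) × Fin (d + 1) → ℝ} (hr : r ≠ 0) :
    ofCoeffs r ≠ 0 := by
  classical
  intro h
  refine hr (funext fun p => ?_)
  have hm : ∀ q : Fin (d + 1) × Fin (d + 1),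
      (C (r q) * (X 0 ^ (q.1 : ℕ) * X 1 ^ (q.2 : ℕ)) : MvPolynomial (Fin 2) ℝ) =
        monomial (Finsupp.single 0 (q.1 : ℕ) + Finsupp.single 1 (q.2 : ℕ)) (r q) := by
    intro q
    rw [X_pow_eq_monomial, X_pow_eq_monomial, monomial_mul, C_mul_monomial]
    simp
  have hc := congrArg (coeff (Finsupp.single 0 (p.1 : ℕ) + Finsupp.single 1 (p.2 : ℕ))) h
  rw [ofCoeffs, coeff_sum, Finset.sum_eq_single p] at hc
  · simpa [hm] using hc
  · intro q _ hq
    rw [hm, coeff_monomial, if_neg]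
    intro heq
    have h0 := DFunLike.congr_fun heq 0
    have h1 := DFunLike.congr_fun heq 1
    simp at h0 h1
    exact hq (Prod.ext (Fin.ext h0) (Fin.ext h1))
  · simp

lemma eval_ofCoeffs {d : ℕ} (r : Fin (d + 1) × Fin (d + 1) → ℝ) (x y : ℝ) :
    eval ![x, y] (ofCoeffs r) = ∑ p, r p * (x ^ (p.1 : ℕ) * y ^ (p.2 : ℕ)) := by
  simp [ofCoeffs]

/-- The pull-back of real polynomials in the coordinates, with denominators cleared. -/
def clearedEval (d : ℕ) (q H : ℂ → ℂ) : (Fin (d + 1) × Fin (d + 1) → ℝ) →ₗ[ℝ] (ℂ → ℂ) where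
  toFun r z := ∑ p, (r p : ℂ) * (((z * q z + H z) / 2) ^ (p.1 : ℕ) *
    (-Complex.I * (z * q z - H z) / 2) ^ (p.2 : ℕ) * q z ^ (2 * d - p.1 - p.2))
  map_add' r s := by
    ext z
    simp [add_mul, Finset.sum_add_distrib]
  map_smul' c r := by
    ext z
    simp [Finset.mul_sum, mul_assoc]

lemma DiffContOnCl.list_prod_sub (L : List ℂ) (Ω : Set ℂ) :
    DiffContOnCl ℂ (fun z => (L.map fun w => z - w).prod) Ω := by
  apply Differentiable.diffContOnCl
  induction L with
  | nil => simp
  | cons w L ih =>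
    simp only [List.map_cons, List.prod_cons]
    exact (differentiable_id.sub_const w).mul ih

lemma DiffContOnCl.mul' {f g : ℂ → ℂ} {Ω : Set ℂ} (hf : DiffContOnCl ℂ f Ω)
    (hg : DiffContOnCl ℂ g Ω) : DiffContOnCl ℂ (fun z => f z * g z) Ω :=
  ⟨hf.differentiableOn.mul hg.differentiableOn, hf.continuousOn.mul hg.continuousOn⟩

lemma clearedEval_diffContOnCl {d : ℕ} {q H : ℂ → ℂ} {Ω : Set ℂ} (hq : DiffContOnCl ℂ q Ω)
    (hH : DiffContOnCl ℂ H Ω) (r : Fin (d + 1) × Fin (d + 1) → ℝ) :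
    DiffContOnCl ℂ (clearedEval d q H r) Ω := by
  have hid : DiffContOnCl ℂ (fun z : ℂ => z) Ω := differentiable_id.diffContOnCl
  have h1 := hid.mul' hq
  constructor
  · have := hq.differentiableOn
    have := hH.differentiableOn
    have := h1.differentiableOn
    change DifferentiableOn ℂ (fun z => ∑ p, _) Ω
    fun_prop
  · have := hq.continuousOn
    have := hH.continuousOn
    have := h1.continuousOn
    change ContinuousOn (fun z => ∑ p, _) (closure Ω)
    fun_prop

/-- If `conj z` agrees on the boundary of a bounded domain with a meromorphic function, then the
boundary lies in a real algebraic curve. -/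
lemma exists_polynomial_vanishing_on_frontier {Ω : Set ℂ} (hΩ : IsOpen Ω) (hc : IsConnected Ω)
    (hb : Bornology.IsBounded Ω) (L : List ℂ) (hL : ∀ w ∈ L, w ∈ Ω) {H : ℂ → ℂ}
    (hH : DiffContOnCl ℂ H Ω)
    (hS : ∀ z ∈ frontier Ω, (L.map fun w => z - w).prod * conj z = H z) :
    ∃ F : MvPolynomial (Fin 2) ℝ, F ≠ 0 ∧ ∀ z ∈ frontier Ω, eval ![z.re, z.im] F = 0 := by
  obtain ⟨z₀, hz₀⟩ := hc.nonempty
  set q : ℂ → ℂ := fun z => (L.map fun w => z - w).prod with hq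
  set d := 4 * L.length + 1 with hd
  set L' : List ℂ := z₀ :: (List.replicate (2 * d) L).flatten with hL'
  have hprod : ∀ z, (L'.map fun w => z - w).prod = (z - z₀) * q z ^ (2 * d) := by
    intro z
    simp [hL', hq, List.map_flatten, List.prod_flatten]
  have hqd : DiffContOnCl ℂ q Ω := DiffContOnCl.list_prod_sub L Ω
  obtain ⟨r, hr, K, hK, hrK⟩ := exists_ne_zero_eq_prod_mul hΩ L'
    (by
      intro w hw
      simp only [hL', List.mem_cons, List.mem_flatten, List.mem_replicate] at hw
      rcases hw with rfl | ⟨l, ⟨_, rfl⟩, hl⟩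
      exacts [hz₀, hL w hl])
    (Fin (d + 1) × Fin (d + 1) → ℝ) (clearedEval d q H)
    (clearedEval_diffContOnCl hqd hH)
    (by
      have : L'.length = 1 + 2 * d * L.length := by simp [hL']; ring
      rw [this]
      simp only [Module.finrank_fintype_fun_eq_card, Fintype.card_prod, Fintype.card_fin]
      rw [hd]
      nlinarith)
  refine ⟨ofCoeffs r, ofCoeffs_ne_zero hr, ?_⟩
  have hF : ∀ z ∈ frontier Ω, (z - z₀) * K z = (eval ![z.re, z.im] (ofCoeffs r) : ℝ) := by
    intro z hz
    have hzΩ : z ∉ Ω := fun h => by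
      rw [hΩ.frontier_eq] at hz
      exact hz.2 h
    have hq0 : q z ≠ 0 := by
      simp only [hq, ne_eq, List.prod_eq_zero_iff, List.mem_map, not_exists, not_and]
      intro w hw h
      exact hzΩ (sub_eq_zero.1 h ▸ hL w hw)
    have h1 := hrK z
    have e1 : (z * q z + H z) / 2 = q z * (z.re : ℂ) := by
      rw [← hS z hz, Complex.re_eq_add_conj]
      ring
    have e2 : -Complex.I * (z * q z - H z) / 2 = q z * (z.im : ℂ) := by
      rw [← hS z hz, Complex.im_eq_sub_conj]
      field_simp
      linear_combination (-q z * (z - conj z)) * Complex.I_sq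
    have h2 : clearedEval d q H r z = q z ^ (2 * d) * (eval ![z.re, z.im] (ofCoeffs r) : ℝ) := by
      change ∑ p, _ = _
      rw [eval_ofCoeffs, Complex.ofReal_sum, Finset.mul_sum]
      refine Finset.sum_congr rfl fun p _ => ?_
      rw [e1, e2, mul_pow, mul_pow]
      have : q z ^ (2 * d) = q z ^ (p.1 : ℕ) * q z ^ (p.2 : ℕ) * q z ^ (2 * d - p.1 - p.2) := by
        rw [← pow_add, ← pow_add]
        congr 1
        have := p.1.2
        have := p.2.2
        omega
      rw [this]
      push_cast
      ring
    rw [hprod, h2] at h1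
    refine mul_left_cancel₀ (pow_ne_zero (2 * d) hq0) ?_
    rw [h1]
    ring
  have hz : ∀ z ∈ frontier Ω, (z - z₀) * K z = 0 := by
    refine eqOn_frontier_zero_of_real hΩ hc.isPreconnected hb
      ((differentiable_id.sub_const z₀).diffContOnCl.mul' hK) hz₀ (by simp) fun z hz => ?_
    have := hF z hz
    change ((z - z₀) * K z).im = 0
    rw [this, Complex.ofReal_im]
  intro z hzf
  have := hF z hzf
  rw [hz z hzf] at this
  exact_mod_cast this.symm

end Algebraic

section RieszKernel

open scoped ENNReal

/-- The Riesz potential of a set of finite measure is bounded. -/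
lemma exists_setLIntegral_norm_rpow_le {E : Type*} [NormedAddCommGroup E] [NormedSpace ℝ E]
    [FiniteDimensional ℝ E] [MeasurableSpace E] [BorelSpace E] (μ : Measure E) [μ.IsAddHaarMeasure]
    {α : ℝ} (h0 : 0 ≤ α) (hd : 1 ≤ Module.finrank ℝ E) (hα : α < Module.finrank ℝ E) {s : Set E}
    (hs : μ s < ⊤) :
    ∃ M : ℝ≥0∞, M ≠ ⊤ ∧ ∀ ζ, ∫⁻ z in s, ENNReal.ofReal (‖z - ζ‖ ^ (-α)) ∂μ ≤ M := by
  have hmeas : Measurable fun z : E => ENNReal.ofReal (‖z‖ ^ (-α)) := by fun_prop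
  have hball : ∫⁻ z in ball (0 : E) 1, ENNReal.ofReal (‖z‖ ^ (-α)) ∂μ < ⊤ := by
    have hi : IntegrableOn (fun z : E => ‖z‖ ^ (-α)) (ball 0 1) μ := by
      refine integrableOn_ball_of_norm_le_rpow (C := 1) (α := α) hd hα ?_ ?_
      · filter_upwards with z
        rw [one_mul, Real.norm_of_nonneg (by positivity)]
      · exact (by fun_prop : Measurable fun z : E => ‖z‖ ^ (-α)).aestronglyMeasurable
    exact hi.lintegral_lt_top
  refine ⟨(∫⁻ z in ball (0 : E) 1, ENNReal.ofReal (‖z‖ ^ (-α)) ∂μ) + μ s,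
    (ENNReal.add_lt_top.2 ⟨hball, hs⟩).ne, fun ζ => ?_⟩
  set g : E → ℝ≥0∞ := (ball (0 : E) 1).indicator fun z => ENNReal.ofReal (‖z‖ ^ (-α)) with hg
  have hgm : Measurable g := hmeas.indicator measurableSet_ball
  calc ∫⁻ z in s, ENNReal.ofReal (‖z - ζ‖ ^ (-α)) ∂μ
      ≤ ∫⁻ z in s, (g (z - ζ) + 1) ∂μ := by
        refine lintegral_mono fun z => ?_
        by_cases hz : z - ζ ∈ ball (0 : E) 1
        · simp [hg, indicator_of_mem hz]
        · simp only [hg, indicator_of_notMem hz, zero_add]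
          refine ENNReal.ofReal_le_one.2 (Real.rpow_le_one_of_one_le_of_nonpos ?_ (by linarith))
          simpa using hz
    _ = (∫⁻ z in s, g (z - ζ) ∂μ) + μ s := by
        rw [lintegral_add_right _ measurable_const]
        simp
    _ ≤ (∫⁻ z, g (z - ζ) ∂μ) + μ s := by
        gcongr
        exact Measure.restrict_le_self
    _ = _ := by
        rw [lintegral_sub_right_eq_self g ζ, hg, lintegral_indicator measurableSet_ball]

end RieszKernel

section CauchyTransform

open scoped ENNReal Topology
open Filter

/-- The kernels `(z - ζ)⁻¹ ^ (k + 1)` are integrable away from the measure. -/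
lemma integrable_inv_pow {ν : Measure ℂ} [IsFiniteMeasure ν] {U : Set ℂ} (hU : IsOpen U)
    (hν : ∀ᵐ ζ ∂ν, ζ ∉ U) {z : ℂ} (hz : z ∈ U) (k : ℕ) :
    Integrable (fun ζ => (z - ζ)⁻¹ ^ k) ν := by
  obtain ⟨r, hr, hball⟩ := Metric.isOpen_iff.1 hU z hz
  refine Integrable.of_bound (C := (r⁻¹) ^ k) ?_ ?_
  · exact (by fun_prop : Measurable fun ζ : ℂ => (z - ζ)⁻¹ ^ k).aestronglyMeasurable
  · filter_upwards [hν] with ζ hζ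
    have : r ≤ ‖z - ζ‖ := by
      by_contra! h
      exact hζ (hball (by rwa [mem_ball_iff_norm']))
    rw [norm_pow, norm_inv]
    gcongr

/-- Differentiation of the Cauchy transform of a measure. -/
lemma hasDerivAt_integral_inv_pow {ν : Measure ℂ} [IsFiniteMeasure ν] {U : Set ℂ} (hU : IsOpen U)
    (hν : ∀ᵐ ζ ∂ν, ζ ∉ U) {z : ℂ} (hz : z ∈ U) (k : ℕ) :
    HasDerivAt (fun z => ∫ ζ, (z - ζ)⁻¹ ^ (k + 1) ∂ν)
      (-(k + 1) * ∫ ζ, (z - ζ)⁻¹ ^ (k + 2) ∂ν) z := by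
  obtain ⟨r, hr, hball⟩ := Metric.isOpen_iff.1 hU z hz
  rw [← integral_const_mul]
  refine (hasDerivAt_integral_of_dominated_loc_of_deriv_le (s := ball z (r / 2))
    (F' := fun z ζ => -(k + 1) * (z - ζ)⁻¹ ^ (k + 2))
    (bound := fun _ => (k + 1) * ((r / 2)⁻¹) ^ (k + 2))
    (ball_mem_nhds z (by positivity)) ?_ (integrable_inv_pow hU hν hz (k + 1)) ?_ ?_
    (integrable_const _) ?_).2
  · filter_upwards with x
    exact (by fun_prop : Measurable fun ζ : ℂ => (x - ζ)⁻¹ ^ (k + 1)).aestronglyMeasurable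
  · exact (by fun_prop :
      Measurable fun ζ : ℂ => -((k : ℂ) + 1) * (z - ζ)⁻¹ ^ (k + 2)).aestronglyMeasurable
  · filter_upwards [hν] with ζ hζ x hx
    have h1 : r ≤ ‖z - ζ‖ := by
      by_contra! h
      exact hζ (hball (by rwa [mem_ball_iff_norm']))
    have h2 : r / 2 ≤ ‖x - ζ‖ := by
      rw [mem_ball_iff_norm'] at hx
      have := norm_sub_le_norm_sub_add_norm_sub z x ζ
      linarith
    rw [norm_mul, norm_neg, norm_pow, norm_inv]
    have h3 : ‖(k : ℂ) + 1‖ = k + 1 := by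
      have := Complex.norm_natCast (k + 1)
      push_cast at this
      exact this
    rw [h3]
    gcongr
  · filter_upwards [hν] with ζ hζ x hx
    have hx' : x - ζ ≠ 0 := by
      intro h
      rw [sub_eq_zero] at h
      exact hζ (hball (ball_subset_ball (by linarith) (h ▸ hx)))
    have h := ((((hasDerivAt_id x).sub_const ζ).inv hx').pow (k + 1))
    refine h.congr_deriv ?_
    simp only [Pi.inv_apply, id, Nat.add_sub_cancel]
    push_cast
    rw [div_eq_mul_inv, ← inv_pow]
    ring

lemma iteratedDerivWithin_integral_inv {ν : Measure ℂ} [IsFiniteMeasure ν] {U : Set ℂ}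
    (hU : IsOpen U) (hν : ∀ᵐ ζ ∂ν, ζ ∉ U) (k : ℕ) :
    ∀ z ∈ U, iteratedDerivWithin k (fun z => ∫ ζ, (z - ζ)⁻¹ ∂ν) U z =
      (-1) ^ k * k.factorial * ∫ ζ, (z - ζ)⁻¹ ^ (k + 1) ∂ν := by
  induction k with
  | zero => simp
  | succ k ih =>
    intro z hz
    rw [iteratedDerivWithin_succ, derivWithin_congr ih (ih z hz), derivWithin_of_isOpen hU hz]
    have h := (hasDerivAt_integral_inv_pow hU hν hz k).const_mul ((-1 : ℂ) ^ k * k.factorial)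
    rw [h.deriv, Nat.factorial_succ]
    push_cast
    ring

/-- The Cauchy transform of a plane set, without the factor `-1 / π`. -/
def areaCauchy (Ω : Set ℂ) (ζ : ℂ) : ℂ := ∫ z in Ω, (z - ζ)⁻¹

lemma enorm_inv_sub (z ζ : ℂ) : ‖(z - ζ)⁻¹‖ₑ = ENNReal.ofReal (‖z - ζ‖ ^ (-1 : ℝ)) := by
  rw [← ofReal_norm, norm_inv, Real.rpow_neg_one]

lemma integrableOn_inv_sub {Ω : Set ℂ} (hA : volume Ω < ⊤) (ζ : ℂ) :
    IntegrableOn (fun z => (z - ζ)⁻¹) Ω := by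
  obtain ⟨M, hM, h⟩ := exists_setLIntegral_norm_rpow_le (volume : Measure ℂ) (α := 1) (by norm_num)
    (by simp) (by simp) hA
  refine ⟨(by fun_prop : Measurable fun z : ℂ => (z - ζ)⁻¹).aestronglyMeasurable, ?_⟩
  rw [hasFiniteIntegral_iff_enorm]
  simp_rw [enorm_inv_sub]
  exact (h ζ).trans_lt hM.lt_top

lemma norm_inv_sub_inv_le {a b : ℂ} (ha : a ≠ 0) (hb : b ≠ 0) :
    ‖a⁻¹ - b⁻¹‖ ≤ 2 * ‖a - b‖ ^ (1 / 2 : ℝ) * (‖a‖ ^ (-(3 / 2) : ℝ) + ‖b‖ ^ (-(3 / 2) : ℝ)) := by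
  wlog hab : ‖a‖ ≤ ‖b‖ generalizing a b
  · have := this hb ha (le_of_not_ge hab)
    rwa [norm_sub_rev, norm_sub_rev b a, add_comm] at this
  have hA : 0 < ‖a‖ := norm_pos_iff.2 ha
  have hB : 0 < ‖b‖ := norm_pos_iff.2 hb
  have hd : ‖a - b‖ ≤ 2 * ‖b‖ := by
    have := norm_sub_le a b
    linarith
  have e1 : ‖a⁻¹ - b⁻¹‖ = ‖a - b‖ ^ (1 / 2 : ℝ) * (‖a - b‖ ^ (1 / 2 : ℝ) * ‖a‖⁻¹ * ‖b‖⁻¹) := by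
    rw [inv_sub_inv ha hb, norm_div, norm_mul, norm_sub_rev]
    have : ‖a - b‖ = ‖a - b‖ ^ (1 / 2 : ℝ) * ‖a - b‖ ^ (1 / 2 : ℝ) := by
      rw [← Real.mul_rpow (by positivity) (by positivity), ← Real.sqrt_eq_rpow,
        Real.sqrt_mul_self (by positivity)]
    nth_rewrite 1 [this]
    field_simp
  have e2 : ‖a - b‖ ^ (1 / 2 : ℝ) ≤ 2 * ‖b‖ ^ (1 / 2 : ℝ) := by
    calc ‖a - b‖ ^ (1 / 2 : ℝ) ≤ (2 * ‖b‖) ^ (1 / 2 : ℝ) := by gcongr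
      _ = 2 ^ (1 / 2 : ℝ) * ‖b‖ ^ (1 / 2 : ℝ) := Real.mul_rpow (by norm_num) hB.le
      _ ≤ 2 ^ (1 : ℝ) * ‖b‖ ^ (1 / 2 : ℝ) := by
        gcongr <;> norm_num
      _ = _ := by norm_num
  have e3 : ‖b‖ ^ (1 / 2 : ℝ) * ‖b‖⁻¹ ≤ ‖a‖ ^ (-(1 / 2) : ℝ) := by
    calc ‖b‖ ^ (1 / 2 : ℝ) * ‖b‖⁻¹ = ‖b‖ ^ (-(1 / 2) : ℝ) := by
          rw [← Real.rpow_neg_one, ← Real.rpow_add hB]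
          norm_num
      _ ≤ _ := Real.rpow_le_rpow_of_nonpos hA hab (by norm_num)
  have e4 : ‖a‖ ^ (-(3 / 2) : ℝ) = ‖a‖ ^ (-(1 / 2) : ℝ) * ‖a‖⁻¹ := by
    rw [← Real.rpow_neg_one, ← Real.rpow_add hA]
    norm_num
  calc ‖a⁻¹ - b⁻¹‖ = ‖a - b‖ ^ (1 / 2 : ℝ) * (‖a - b‖ ^ (1 / 2 : ℝ) * ‖a‖⁻¹ * ‖b‖⁻¹) := e1
    _ ≤ ‖a - b‖ ^ (1 / 2 : ℝ) * (2 * ‖b‖ ^ (1 / 2 : ℝ) * ‖a‖⁻¹ * ‖b‖⁻¹) := by gcongr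
    _ = 2 * ‖a - b‖ ^ (1 / 2 : ℝ) * ((‖b‖ ^ (1 / 2 : ℝ) * ‖b‖⁻¹) * ‖a‖⁻¹) := by ring
    _ ≤ 2 * ‖a - b‖ ^ (1 / 2 : ℝ) * (‖a‖ ^ (-(1 / 2) : ℝ) * ‖a‖⁻¹) := by gcongr
    _ ≤ _ := by
      rw [← e4]
      gcongr
      have : 0 ≤ ‖b‖ ^ (-(3 / 2) : ℝ) := by positivity
      linarith

lemma continuous_areaCauchy {Ω : Set ℂ} (hA : volume Ω < ⊤) : Continuous (areaCauchy Ω) := by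
  obtain ⟨M, hM, hMle⟩ := exists_setLIntegral_norm_rpow_le (volume : Measure ℂ) (α := 3 / 2)
    (by norm_num) (by simp) (by simp; norm_num) hA
  have h_int : ∀ ζ : ℂ, IntegrableOn (fun z => ‖z - ζ‖ ^ (-(3 / 2) : ℝ)) Ω ∧
      ∫ z in Ω, ‖z - ζ‖ ^ (-(3 / 2) : ℝ) ≤ M.toReal := by
    intro ζ
    have hm : Measurable fun z : ℂ => ‖z - ζ‖ ^ (-(3 / 2) : ℝ) := by fun_prop
    have hnn : ∀ z : ℂ, 0 ≤ ‖z - ζ‖ ^ (-(3 / 2) : ℝ) := fun z => by positivity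
    constructor
    · refine ⟨hm.aestronglyMeasurable, ?_⟩
      rw [hasFiniteIntegral_iff_ofReal (ae_of_all _ hnn)]
      exact (hMle ζ).trans_lt hM.lt_top
    · rw [integral_eq_lintegral_of_nonneg_ae (ae_of_all _ hnn) hm.aestronglyMeasurable]
      exact ENNReal.toReal_mono hM (hMle ζ)
  have hbound : ∀ ζ ζ' : ℂ, ‖areaCauchy Ω ζ' - areaCauchy Ω ζ‖ ≤
      2 * ‖ζ' - ζ‖ ^ (1 / 2 : ℝ) * (M.toReal + M.toReal) := by
    intro ζ ζ'
    rw [areaCauchy, areaCauchy, ← integral_sub (integrableOn_inv_sub hA ζ')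
      (integrableOn_inv_sub hA ζ)]
    have hne : ∀ ζ : ℂ, ∀ᵐ z ∂(volume.restrict Ω), z - ζ ≠ 0 := by
      intro ζ
      refine ae_restrict_of_ae ?_
      filter_upwards [(measure_singleton ζ : (volume : Measure ℂ) {ζ} = 0) |> compl_mem_ae_iff.2]
        with z hz
      simpa [sub_eq_zero] using hz
    calc ‖∫ z in Ω, ((z - ζ')⁻¹ - (z - ζ)⁻¹)‖
        ≤ ∫ z in Ω, 2 * ‖ζ' - ζ‖ ^ (1 / 2 : ℝ) *
          (‖z - ζ'‖ ^ (-(3 / 2) : ℝ) + ‖z - ζ‖ ^ (-(3 / 2) : ℝ)) := by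
          refine norm_integral_le_of_norm_le (((h_int ζ').1.add (h_int ζ).1).const_mul _) ?_
          filter_upwards [hne ζ, hne ζ'] with z h1 h2
          have := norm_inv_sub_inv_le h2 h1
          rwa [sub_sub_sub_cancel_left, norm_sub_rev ζ ζ'] at this
      _ = 2 * ‖ζ' - ζ‖ ^ (1 / 2 : ℝ) * ((∫ z in Ω, ‖z - ζ'‖ ^ (-(3 / 2) : ℝ)) +
          ∫ z in Ω, ‖z - ζ‖ ^ (-(3 / 2) : ℝ)) := by
          rw [integral_const_mul, integral_add (h_int ζ').1 (h_int ζ).1]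
      _ ≤ _ := by
          gcongr
          exacts [(h_int ζ').2, (h_int ζ).2]
  rw [continuous_iff_continuousAt]
  intro ζ
  rw [ContinuousAt, tendsto_iff_norm_sub_tendsto_zero]
  refine squeeze_zero (fun _ => norm_nonneg _) (hbound ζ) ?_
  have hc : Continuous fun ζ' : ℂ => 2 * ‖ζ' - ζ‖ ^ (1 / 2 : ℝ) * (M.toReal + M.toReal) := by
    have : Continuous fun ζ' : ℂ => ‖ζ' - ζ‖ ^ (1 / 2 : ℝ) :=
      (continuous_id.sub continuous_const).norm.rpow_const fun _ => Or.inr (by norm_num)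
    fun_prop
  simpa using hc.tendsto ζ

lemma integral_inv_circleMap_sub_of_lt {ρ : ℝ} (hρ : 0 < ρ) {ζ : ℂ} (h : ρ < ‖ζ‖) :
    ∫ θ in -Real.pi..Real.pi, (circleMap 0 ρ θ - ζ)⁻¹ = -(2 * Real.pi) * ζ⁻¹ := by
  have hper : Function.Periodic (fun θ => (circleMap 0 ρ θ - ζ)⁻¹) (2 * Real.pi) := fun θ => by
    simp only [periodic_circleMap 0 ρ θ]
  have hshift := hper.intervalIntegral_add_eq (-Real.pi) 0
  rw [show -Real.pi + 2 * Real.pi = Real.pi by ring, zero_add] at hshift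
  have hne : ∀ z ∈ closedBall (0 : ℂ) ρ, z - ζ ≠ 0 := by
    intro z hz h0
    rw [sub_eq_zero] at h0
    rw [mem_closedBall_zero_iff, h0] at hz
    linarith
  have hd : DiffContOnCl ℂ (fun z => (z - ζ)⁻¹) (ball 0 |ρ|) := by
    rw [abs_of_pos hρ]
    refine ⟨fun z hz => ?_, fun z hz => ?_⟩
    · exact ((differentiableAt_id.sub_const ζ).inv
        (hne z (ball_subset_closedBall hz))).differentiableWithinAt
    · exact ((continuousAt_id.sub continuousAt_const).inv₀
        (hne z (closure_ball_subset_closedBall hz))).continuousWithinAt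
  have h1 := hd.circleAverage
  rw [Real.circleAverage_def, zero_sub, inv_smul_eq_iff₀ (by positivity)] at h1
  rw [hshift, h1, Complex.real_smul, inv_neg]
  push_cast
  ring

lemma integral_inv_circleMap_sub_of_gt {ρ : ℝ} {ζ : ℂ} (h : ‖ζ‖ < ρ) :
    ∫ θ in -Real.pi..Real.pi, (circleMap 0 ρ θ - ζ)⁻¹ = 0 := by
  have hρ : 0 < ρ := (norm_nonneg _).trans_lt h
  have hper : Function.Periodic (fun θ => (circleMap 0 ρ θ - ζ)⁻¹) (2 * Real.pi) := fun θ => by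
    simp only [periodic_circleMap 0 ρ θ]
  have hshift := hper.intervalIntegral_add_eq (-Real.pi) 0
  rw [show -Real.pi + 2 * Real.pi = Real.pi by ring, zero_add] at hshift
  rw [hshift]
  have hw : ∀ w ∈ ball (0 : ℂ) ρ, ∮ z in C(0, ρ), (z - w)⁻¹ = 2 * Real.pi * Complex.I :=
    fun w hw => circleIntegral.integral_sub_inv_of_mem_ball hw
  have hζ : ζ ∈ ball (0 : ℂ) ρ := by simpa using h
  have hdef : ∀ θ : ℝ, circleMap 0 ρ θ ≠ 0 := fun θ => by simp [circleMap, hρ.ne']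
  have hdef' : ∀ θ : ℝ, circleMap 0 ρ θ - ζ ≠ 0 := fun θ =>
    sub_ne_zero.2 (circleMap_ne_mem_ball hζ θ)
  by_cases h0 : ζ = 0
  · subst h0
    have h1 := circleIntegral.integral_sub_zpow_of_ne (n := -2) (by norm_num) 0 0 ρ
    rw [circleIntegral] at h1
    have h2 : ∀ θ : ℝ, deriv (circleMap 0 ρ) θ • (circleMap 0 ρ θ - 0) ^ (-2 : ℤ) =
        Complex.I * (circleMap 0 ρ θ - 0)⁻¹ := by
      intro θ
      have := hdef θ
      rw [deriv_circleMap, sub_zero, smul_eq_mul, zpow_neg, zpow_ofNat]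
      field_simp
    simp_rw [h2] at h1
    rw [intervalIntegral.integral_const_mul] at h1
    exact (mul_eq_zero.1 h1).resolve_left Complex.I_ne_zero
  · have hci : ∀ w ∈ ball (0 : ℂ) ρ, CircleIntegrable (fun z => (z - w)⁻¹) 0 ρ := by
      intro w hw
      refine circleIntegrable_sub_inv_iff.2 (Or.inr fun hs => ?_)
      rw [abs_of_pos hρ] at hs
      exact (sphere_disjoint_ball.ne_of_mem hs hw) rfl
    have h1 := circleIntegral.integral_sub (hci ζ hζ) (hci 0 (by simpa using hρ))
    rw [hw ζ hζ, hw 0 (by simpa using hρ), sub_self, circleIntegral] at h1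
    have h2 : ∀ θ : ℝ, deriv (circleMap 0 ρ) θ • ((circleMap 0 ρ θ - ζ)⁻¹ - (circleMap 0 ρ θ - 0)⁻¹)
        = (Complex.I * ζ) * (circleMap 0 ρ θ - ζ)⁻¹ := by
      intro θ
      have := hdef θ
      have := hdef' θ
      rw [deriv_circleMap, sub_zero, smul_eq_mul]
      field_simp
      ring
    simp_rw [h2] at h1
    rw [intervalIntegral.integral_const_mul] at h1
    exact (mul_eq_zero.1 h1).resolve_left (mul_ne_zero Complex.I_ne_zero h0)

lemma setIntegral_ball_zero_inv_sub {r : ℝ} {ζ : ℂ} (hζ : ‖ζ‖ < r) :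
    ∫ z in ball (0 : ℂ) r, (z - ζ)⁻¹ = -Real.pi * conj ζ := by
  have hr : 0 < r := (norm_nonneg _).trans_lt hζ
  set f : ℂ → ℂ := (ball (0 : ℂ) r).indicator fun z => (z - ζ)⁻¹ with hf
  have hfm : Measurable f := (by fun_prop : Measurable fun z : ℂ => (z - ζ)⁻¹).indicator
    measurableSet_ball
  have hfi : Integrable f := (integrable_indicator_iff measurableSet_ball).2
    (integrableOn_inv_sub measure_ball_lt_top ζ)
  have hsymm : ∀ p : ℝ × ℝ, Complex.polarCoord.symm p = circleMap 0 p.1 p.2 := by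
    intro p
    rw [Complex.polarCoord_symm_apply, circleMap, zero_add, Complex.exp_mul_I,
      Complex.ofReal_cos, Complex.ofReal_sin]
  have hpm : Measurable fun p : ℝ × ℝ => circleMap 0 p.1 p.2 := by
    unfold circleMap
    fun_prop
  rw [← integral_indicator measurableSet_ball, ← hf, ← Complex.integral_comp_polarCoord_symm f,
    polarCoord_target]
  simp_rw [hsymm]
  have h_int : IntegrableOn (fun p : ℝ × ℝ => p.1 • f (circleMap 0 p.1 p.2))
      (Ioi 0 ×ˢ Ioo (-Real.pi) Real.pi) := by
    refine ⟨(measurable_fst.smul (hfm.comp hpm)).aestronglyMeasurable, ?_⟩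
    have h1 := Complex.lintegral_comp_polarCoord_symm fun z => ‖f z‖ₑ
    have h2 := hfi.hasFiniteIntegral
    rw [hasFiniteIntegral_iff_enorm, ← h1, polarCoord_target] at h2
    rw [hasFiniteIntegral_iff_enorm]
    refine lt_of_le_of_lt (le_of_eq ?_) h2
    refine setLIntegral_congr_fun (measurableSet_Ioi.prod measurableSet_Ioo) fun p hp => ?_
    simp only [hsymm, smul_eq_mul]
    rw [enorm_smul, Real.enorm_eq_ofReal (le_of_lt hp.1)]
  rw [Measure.volume_eq_prod, setIntegral_prod _ h_int]
  have hinner : ∀ ρ ∈ Ioi (0 : ℝ), ρ ≠ ‖ζ‖ →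
      ∫ θ in Ioo (-Real.pi) Real.pi, ρ • f (circleMap 0 ρ θ) =
        (Ioc 0 ‖ζ‖).indicator (fun ρ : ℝ => (ρ : ℂ) * (-(2 * Real.pi) * ζ⁻¹)) ρ := by
    intro ρ hρ hne
    have hρ' : (0 : ℝ) < ρ := hρ
    rw [integral_smul, ← integral_Ioc_eq_integral_Ioo,
      ← intervalIntegral.integral_of_le (by linarith [Real.pi_pos])]
    by_cases hρr : ρ < r
    · have : ∀ θ, f (circleMap 0 ρ θ) = (circleMap 0 ρ θ - ζ)⁻¹ := by
        intro θ
        rw [hf, indicator_of_mem]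
        simpa [abs_of_pos hρ'] using hρr
      simp_rw [this]
      rcases lt_or_gt_of_ne hne with h | h
      · rw [integral_inv_circleMap_sub_of_lt hρ' h, indicator_of_mem (by exact ⟨hρ', h.le⟩)]
        simp
      · rw [integral_inv_circleMap_sub_of_gt h, indicator_of_notMem (fun hm => by
          have := hm.2
          linarith)]
        simp
    · have : ∀ θ, f (circleMap 0 ρ θ) = 0 := by
        intro θ
        rw [hf, indicator_of_notMem]
        simpa [abs_of_pos hρ'] using hρr
      simp_rw [this]
      rw [indicator_of_notMem (fun hm => by
          have := hm.2
          linarith)]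
      simp
  have hae : ∀ᵐ ρ ∂(volume.restrict (Ioi (0 : ℝ))),
      ∫ θ in Ioo (-Real.pi) Real.pi, ρ • f (circleMap 0 ρ θ) =
        (Ioc 0 ‖ζ‖).indicator (fun ρ : ℝ => (ρ : ℂ) * (-(2 * Real.pi) * ζ⁻¹)) ρ := by
    filter_upwards [ae_restrict_mem measurableSet_Ioi, ae_restrict_of_ae
      (compl_mem_ae_iff.2 (measure_singleton ‖ζ‖ : (volume : Measure ℝ) {‖ζ‖} = 0))] with ρ h1 h2
      using hinner ρ h1 h2
  rw [integral_congr_ae hae, setIntegral_indicator measurableSet_Ioc,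
    inter_eq_self_of_subset_right Ioc_subset_Ioi_self,
    ← intervalIntegral.integral_of_le (norm_nonneg ζ), intervalIntegral.integral_mul_const,
    intervalIntegral.integral_ofReal, integral_id]
  by_cases h0 : ζ = 0
  · simp [h0]
  · have : ((‖ζ‖ : ℝ) : ℂ) ^ 2 = ζ * conj ζ := (Complex.mul_conj' ζ).symm
    push_cast
    rw [this]
    field_simp
    ring

lemma setIntegral_ball_inv_sub {r : ℝ} {a ζ : ℂ} (hζ : ζ ∈ ball a r) :
    ∫ z in ball a r, (z - ζ)⁻¹ = -Real.pi * conj (ζ - a) := by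
  have h := setIntegral_ball_zero_inv_sub (ζ := ζ - a) (mem_ball_iff_norm.1 hζ)
  rw [← h, ← integral_indicator measurableSet_ball, ← integral_indicator measurableSet_ball,
    ← integral_add_right_eq_self _ a]
  congr 1
  ext z
  by_cases hz : z ∈ ball (0 : ℂ) r
  · rw [indicator_of_mem hz, indicator_of_mem (by simpa using hz)]
    congr 1
    ring
  · rw [indicator_of_notMem hz, indicator_of_notMem (by simpa using hz)]

/-- The Cauchy transform differs from `-π * conj` by a holomorphic function. -/
lemma differentiableOn_conj_add_areaCauchy {Ω : Set ℂ} (hΩ : IsOpen Ω) (hA : volume Ω < ⊤) :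
    DifferentiableOn ℂ (fun ζ => conj ζ + areaCauchy Ω ζ / Real.pi) Ω := by
  intro a ha
  obtain ⟨r, hr, hball⟩ := Metric.isOpen_iff.1 hΩ a ha
  have hfin : IsFiniteMeasure (volume.restrict (Ω \ ball a r)) :=
    ⟨by simpa using (measure_mono sdiff_subset).trans_lt hA⟩
  have hd := hasDerivAt_integral_inv_pow (ν := volume.restrict (Ω \ ball a r)) (isOpen_ball (x := a)
    (ε := r)) (by
      filter_upwards [ae_restrict_mem (hΩ.measurableSet.diff measurableSet_ball)] with z hz
        using hz.2) (mem_ball_self hr) 0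
  have heq : ∀ ζ ∈ ball a r, conj ζ + areaCauchy Ω ζ / Real.pi =
      conj a - (∫ z in Ω \ ball a r, (ζ - z)⁻¹ ^ (0 + 1)) / Real.pi := by
    intro ζ hζ
    have h1 := setIntegral_sdiff measurableSet_ball (integrableOn_inv_sub hA ζ) hball
    rw [setIntegral_ball_inv_sub hζ] at h1
    have h2 : ∫ z in Ω \ ball a r, (ζ - z)⁻¹ ^ (0 + 1) = -∫ z in Ω \ ball a r, (z - ζ)⁻¹ := by
      rw [← integral_neg]
      congr 1
      ext z
      rw [zero_add, pow_one, ← inv_neg, neg_sub]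
    rw [h2, h1, map_sub, areaCauchy]
    have : (Real.pi : ℂ) ≠ 0 := by exact_mod_cast Real.pi_ne_zero
    field_simp
    ring
  refine DifferentiableAt.differentiableWithinAt ?_
  refine DifferentiableAt.congr_of_eventuallyEq
    ((hd.differentiableAt.div_const (Real.pi : ℂ)).const_sub (conj a)) ?_
  filter_upwards [ball_mem_nhds a hr] with ζ hζ using heq ζ hζ

lemma measurable_ofReal_norm_sub_rpow (α : ℝ) :
    Measurable fun p : ℂ × ℂ => ENNReal.ofReal (‖p.1 - p.2‖ ^ α) := by
  fun_prop

/-- A form of the Cauchy–Schwarz inequality for the Cauchy transform of a measure. -/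
lemma enorm_integral_inv_sub_sq_le (ν : Measure ℂ) (z : ℂ) :
    ‖∫ ζ, (z - ζ)⁻¹ ∂ν‖ₑ ^ 2 ≤ (∫⁻ ζ, ENNReal.ofReal (‖z - ζ‖ ^ (-(1 / 2) : ℝ)) ∂ν) *
      ∫⁻ ζ, ENNReal.ofReal (‖z - ζ‖ ^ (-(3 / 2) : ℝ)) ∂ν := by
  have hsq : ∀ (α : ℝ) (ζ : ℂ), ENNReal.ofReal (‖z - ζ‖ ^ α) ^ (2 : ℝ) =
      ENNReal.ofReal (‖z - ζ‖ ^ (α * 2)) := by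
    intro α ζ
    rw [ENNReal.ofReal_rpow_of_nonneg (by positivity) (by norm_num),
      Real.rpow_mul (norm_nonneg _)]
  have hmul : ∀ ζ : ℂ, ‖(z - ζ)⁻¹‖ₑ = ENNReal.ofReal (‖z - ζ‖ ^ (-(1 / 4) : ℝ)) *
      ENNReal.ofReal (‖z - ζ‖ ^ (-(3 / 4) : ℝ)) := by
    intro ζ
    rw [enorm_inv_sub, ← ENNReal.ofReal_mul (by positivity)]
    rcases eq_or_ne (z - ζ) 0 with h | h
    · rw [h, norm_zero, Real.zero_rpow (by norm_num), Real.zero_rpow (by norm_num), zero_mul]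
    · rw [← Real.rpow_add (norm_pos_iff.2 h)]
      norm_num
  have hm : ∀ α : ℝ, Measurable fun ζ : ℂ => ENNReal.ofReal (‖z - ζ‖ ^ α) := fun α => by fun_prop
  have h1 : ‖∫ ζ, (z - ζ)⁻¹ ∂ν‖ₑ ≤
      (∫⁻ ζ, ENNReal.ofReal (‖z - ζ‖ ^ (-(1 / 2) : ℝ)) ∂ν) ^ (1 / 2 : ℝ) *
      (∫⁻ ζ, ENNReal.ofReal (‖z - ζ‖ ^ (-(3 / 2) : ℝ)) ∂ν) ^ (1 / 2 : ℝ) := by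
    refine (enorm_integral_le_lintegral_enorm _).trans ?_
    simp_rw [hmul]
    refine (ENNReal.lintegral_mul_le_Lp_mul_Lq ν Real.HolderConjugate.two_two
      (hm _).aemeasurable (hm _).aemeasurable).trans (le_of_eq ?_)
    simp_rw [hsq]
    norm_num
  calc ‖∫ ζ, (z - ζ)⁻¹ ∂ν‖ₑ ^ 2
      ≤ ((∫⁻ ζ, ENNReal.ofReal (‖z - ζ‖ ^ (-(1 / 2) : ℝ)) ∂ν) ^ (1 / 2 : ℝ) *
        (∫⁻ ζ, ENNReal.ofReal (‖z - ζ‖ ^ (-(3 / 2) : ℝ)) ∂ν) ^ (1 / 2 : ℝ)) ^ 2 := by gcongr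
    _ = _ := by
      rw [mul_pow, ← ENNReal.rpow_mul_natCast, ← ENNReal.rpow_mul_natCast]
      norm_num

lemma lintegral_lintegral_rpow_lt_top {Ω : Set ℂ} (hA : volume Ω < ⊤) {ν : Measure ℂ}
    [IsFiniteMeasure ν] {α : ℝ} (h0 : 0 ≤ α) (h2 : α < 2) :
    ∫⁻ z in Ω, ∫⁻ ζ, ENNReal.ofReal (‖z - ζ‖ ^ (-α)) ∂ν < ⊤ := by
  obtain ⟨M, hM, hle⟩ := exists_setLIntegral_norm_rpow_le (volume : Measure ℂ) h0
    (by simp) (by simpa using h2) hA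
  have : IsFiniteMeasure (volume.restrict Ω) := ⟨by simpa using hA⟩
  rw [lintegral_lintegral_swap (measurable_ofReal_norm_sub_rpow _).aemeasurable]
  calc ∫⁻ ζ, (∫⁻ z in Ω, ENNReal.ofReal (‖z - ζ‖ ^ (-α))) ∂ν ≤ ∫⁻ _, M ∂ν := lintegral_mono hle
    _ = M * ν univ := lintegral_const M
    _ < ⊤ := ENNReal.mul_lt_top hM.lt_top (measure_lt_top ν univ)

lemma bergmanFun_integral_inv_sub {Ω : Set ℂ} (hΩ : IsOpen Ω) (hA : volume Ω < ⊤) {ν : Measure ℂ}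
    [IsFiniteMeasure ν] (hν : ∀ᵐ ζ ∂ν, ζ ∉ Ω)
    (hpot : ∃ M : ℝ≥0∞, M ≠ ⊤ ∧
      ∀ z, ∫⁻ ζ, ENNReal.ofReal (‖z - ζ‖ ^ (-(1 / 2) : ℝ)) ∂ν ≤ M) :
    BergmanFun Ω fun z => ∫ ζ, (z - ζ)⁻¹ ∂ν := by
  have hd : DifferentiableOn ℂ (fun z => ∫ ζ, (z - ζ)⁻¹ ∂ν) Ω := by
    intro z hz
    have := hasDerivAt_integral_inv_pow hΩ hν hz 0
    simp only [zero_add, pow_one] at this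
    exact this.differentiableAt.differentiableWithinAt
  refine ⟨hd, (hd.continuousOn.norm.pow 2).aestronglyMeasurable hΩ.measurableSet, ?_⟩
  obtain ⟨M, hM, hle⟩ := hpot
  rw [hasFiniteIntegral_iff_enorm]
  calc ∫⁻ z in Ω, ‖‖∫ ζ, (z - ζ)⁻¹ ∂ν‖ ^ 2‖ₑ
      ≤ ∫⁻ z in Ω, M * ∫⁻ ζ, ENNReal.ofReal (‖z - ζ‖ ^ (-(3 / 2) : ℝ)) ∂ν := by
        refine lintegral_mono fun z => ?_
        rw [enorm_pow, enorm_norm]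
        refine (enorm_integral_inv_sub_sq_le ν z).trans ?_
        gcongr
        exact hle z
    _ = M * ∫⁻ z in Ω, ∫⁻ ζ, ENNReal.ofReal (‖z - ζ‖ ^ (-(3 / 2) : ℝ)) ∂ν :=
        lintegral_const_mul' _ _ hM
    _ < ⊤ := ENNReal.mul_lt_top hM.lt_top
        (lintegral_lintegral_rpow_lt_top hA (by norm_num) (by norm_num))

/-- Fubini's theorem for the Cauchy kernel. -/
lemma setIntegral_integral_inv_sub {Ω : Set ℂ} (hA : volume Ω < ⊤) (ν : Measure ℂ)
    [IsFiniteMeasure ν] :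
    ∫ z in Ω, ∫ ζ, (z - ζ)⁻¹ ∂ν = ∫ ζ, areaCauchy Ω ζ ∂ν := by
  have : IsFiniteMeasure (volume.restrict Ω) := ⟨by simpa using hA⟩
  refine integral_integral_swap ⟨(by fun_prop :
    Measurable fun p : ℂ × ℂ => (p.1 - p.2)⁻¹).aestronglyMeasurable, ?_⟩
  rw [hasFiniteIntegral_iff_enorm, lintegral_prod _ (by fun_prop)]
  simp only [Function.uncurry_apply_pair, enorm_inv_sub]
  exact lintegral_lintegral_rpow_lt_top hA (by norm_num) (by norm_num)

/-- The value of a quadrature functional at the Cauchy kernel with pole `ζ`. -/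
def quadratureKernel {N : ℕ} (w : Fin N → ℂ) (n : Fin N → ℕ) (c : Fin N → ℕ → ℂ) (ζ : ℂ) : ℂ :=
  ∑ j, ∑ k ∈ Finset.range (n j + 1),
    c j k * ((-1) ^ k * k.factorial * (w j - ζ)⁻¹ ^ (k + 1))

section Quadrature

variable {Ω : Set ℂ} {N : ℕ} {w : Fin N → ℂ} {n : Fin N → ℕ} {c : Fin N → ℕ → ℂ}

lemma integral_areaCauchy_eq_integral_quadratureKernel (hΩ : IsOpen Ω) (hA : volume Ω < ⊤)
    (hw : ∀ j, w j ∈ Ω)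
    (hq : ∀ f : ℂ → ℂ, BergmanFun Ω f → (∫ z in Ω, f z) =
      ∑ j, ∑ k ∈ Finset.range (n j + 1), c j k * iteratedDerivWithin k f Ω (w j))
    {ν : Measure ℂ} [IsFiniteMeasure ν] (hν : ∀ᵐ ζ ∂ν, ζ ∉ Ω)
    (hpot : ∃ M : ℝ≥0∞, M ≠ ⊤ ∧
      ∀ z, ∫⁻ ζ, ENNReal.ofReal (‖z - ζ‖ ^ (-(1 / 2) : ℝ)) ∂ν ≤ M) :
    ∫ ζ, areaCauchy Ω ζ ∂ν = ∫ ζ, quadratureKernel w n c ζ ∂ν := by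
  have h := hq _ (bergmanFun_integral_inv_sub hΩ hA hν hpot)
  rw [setIntegral_integral_inv_sub hA] at h
  have hi : ∀ j k, Integrable
      (fun ζ => c j k * ((-1) ^ k * k.factorial * (w j - ζ)⁻¹ ^ (k + 1))) ν := fun j k =>
    ((integrable_inv_pow hΩ hν (hw j) (k + 1)).const_mul _).const_mul _
  rw [h]
  unfold quadratureKernel
  rw [integral_finsetSum _ fun j _ => integrable_finsetSum _ fun k _ => hi j k]
  refine Finset.sum_congr rfl fun j _ => ?_
  rw [integral_finsetSum _ fun k _ => hi j k]
  refine Finset.sum_congr rfl fun k _ => ?_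
  rw [iteratedDerivWithin_integral_inv hΩ hν k _ (hw j), integral_const_mul, integral_const_mul]

lemma continuousOn_quadratureKernel (hw : ∀ j, w j ∈ Ω) :
    ContinuousOn (quadratureKernel w n c) Ωᶜ := by
  unfold quadratureKernel
  refine continuousOn_finsetSum _ fun j _ => continuousOn_finsetSum _ fun k _ => ?_
  refine continuousOn_const.mul (continuousOn_const.mul (ContinuousOn.pow ?_ _))
  refine (continuousOn_const.sub continuousOn_id).inv₀ fun ζ hζ h => hζ ?_
  have h' : w j = ζ := sub_eq_zero.1 h
  exact h' ▸ hw j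

/-- The potential of exponent `1 / 2` of a bi-Lipschitz arc is bounded. -/
lemma exists_lintegral_norm_sub_rpow_le {γ : ℝ → ℂ} {a b m : ℝ} (hab : a ≤ b) (hm : 0 < m)
    (hγ : ContinuousOn γ (Icc a b))
    (hlow : ∀ s ∈ Icc a b, ∀ t ∈ Icc a b, m * |s - t| ≤ ‖γ s - γ t‖) :
    ∃ M : ℝ≥0∞, M ≠ ⊤ ∧
      ∀ z, ∫⁻ s in Ioc a b, ENNReal.ofReal (‖z - γ s‖ ^ (-(1 / 2) : ℝ)) ≤ M := by
  obtain ⟨M, hM, hle⟩ := exists_setLIntegral_norm_rpow_le (volume : Measure ℝ) (α := 1 / 2)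
    (by norm_num) (by simp) (by simp; norm_num) (measure_Ioc_lt_top : volume (Ioc a b) < ⊤)
  refine ⟨ENNReal.ofReal ((m / 2) ^ (-(1 / 2) : ℝ)) * M,
    ENNReal.mul_ne_top ENNReal.ofReal_ne_top hM, fun z => ?_⟩
  obtain ⟨t, ht, hmin⟩ := isCompact_Icc.exists_isMinOn (nonempty_Icc.2 hab)
    (continuousOn_const.sub hγ).norm (f := fun s => ‖z - γ s‖)
  have hdist : ∀ s ∈ Icc a b, m / 2 * |s - t| ≤ ‖z - γ s‖ := by
    intro s hs
    have h1 := hlow s hs t ht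
    have h2 : ‖z - γ t‖ ≤ ‖z - γ s‖ := hmin hs
    have h3 := norm_sub_le_norm_sub_add_norm_sub (γ s) z (γ t)
    rw [norm_sub_rev (γ s) z] at h3
    linarith
  calc ∫⁻ s in Ioc a b, ENNReal.ofReal (‖z - γ s‖ ^ (-(1 / 2) : ℝ))
      ≤ ∫⁻ s in Ioc a b, ENNReal.ofReal ((m / 2) ^ (-(1 / 2) : ℝ)) *
          ENNReal.ofReal (‖s - t‖ ^ (-(1 / 2) : ℝ)) := by
        refine lintegral_mono_ae ?_
        filter_upwards [ae_restrict_mem measurableSet_Ioc, ae_restrict_of_ae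
          (compl_mem_ae_iff.2 (measure_singleton t : (volume : Measure ℝ) {t} = 0))] with s hs hst
        have hpos : 0 < |s - t| := abs_pos.2 (sub_ne_zero.2 hst)
        rw [← ENNReal.ofReal_mul (by positivity), Real.norm_eq_abs,
          ← Real.mul_rpow (by positivity) (by positivity)]
        exact ENNReal.ofReal_le_ofReal (Real.rpow_le_rpow_of_nonpos (by positivity)
          (hdist s (Ioc_subset_Icc_self hs)) (by norm_num))
    _ = ENNReal.ofReal ((m / 2) ^ (-(1 / 2) : ℝ)) *
          ∫⁻ s in Ioc a b, ENNReal.ofReal (‖s - t‖ ^ (-(1 / 2) : ℝ)) :=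
        lintegral_const_mul' _ _ ENNReal.ofReal_ne_top
    _ ≤ _ := by
        gcongr
        exact hle t

/-- A map is bi-Lipschitz near a point where its derivative does not vanish. -/
lemma exists_mul_abs_sub_le_norm_sub {γ : ℝ → ℂ} {γ' : ℂ} {t : ℝ} (h : HasStrictDerivAt γ γ' t)
    (h0 : γ' ≠ 0) :
    ∃ m > 0, ∃ δ > 0, ∀ s ∈ Icc (t - δ) (t + δ), ∀ s' ∈ Icc (t - δ) (t + δ),
      m * |s - s'| ≤ ‖γ s - γ s'‖ := by
  have hpos : 0 < ‖γ'‖ := norm_pos_iff.2 h0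
  have h1 := h.isLittleO.def (show 0 < ‖γ'‖ / 2 by positivity)
  rw [nhds_prod_eq] at h1
  obtain ⟨u, hu, v, hv, huv⟩ := Filter.eventually_prod_iff.1 h1
  obtain ⟨δ, hδ, hball⟩ := Metric.mem_nhds_iff.1 (Filter.inter_mem hu hv)
  have hin : ∀ s ∈ Icc (t - δ / 2) (t + δ / 2), s ∈ ball t δ := by
    intro s hs
    rw [Real.ball_eq_Ioo]
    constructor <;> linarith [hs.1, hs.2]
  refine ⟨‖γ'‖ / 2, by positivity, δ / 2, by positivity, fun s hs s' hs' => ?_⟩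
  have h2 := huv (hball (hin s hs)).1 (hball (hin s' hs')).2
  have h3 : ‖(s - s') • γ'‖ = ‖γ'‖ * |s - s'| := by
    rw [norm_smul, Real.norm_eq_abs, mul_comm]
  simp only [ContinuousLinearMap.toSpanSingleton_apply, Real.norm_eq_abs] at h2
  have h4 := norm_sub_norm_le ((s - s') • γ') (γ s - γ s')
  rw [norm_sub_rev ((s - s') • γ'), h3] at h4
  linarith

lemma areaCauchy_eq_quadratureKernel (hΩ : IsOpen Ω) (hA : volume Ω < ⊤)
    (hw : ∀ j, w j ∈ Ω)
    (hq : ∀ f : ℂ → ℂ, BergmanFun Ω f → (∫ z in Ω, f z) =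
      ∑ j, ∑ k ∈ Finset.range (n j + 1), c j k * iteratedDerivWithin k f Ω (w j))
    {γ : ℝ → ℂ} (hγ : ContDiff ℝ 1 γ) (hγΩ : ∀ s, γ s ∉ Ω) {t : ℝ} (ht : deriv γ t ≠ 0) :
    areaCauchy Ω (γ t) = quadratureKernel w n c (γ t) := by
  obtain ⟨m, hm, δ, hδ, hlow⟩ := exists_mul_abs_sub_le_norm_sub
    (hγ.contDiffAt.hasStrictDerivAt one_ne_zero) ht
  set g : ℝ → ℂ := fun s => areaCauchy Ω (γ s) - quadratureKernel w n c (γ s) with hg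
  have hc1 : Continuous fun s => areaCauchy Ω (γ s) := (continuous_areaCauchy hA).comp hγ.continuous
  have hc2 : Continuous fun s => quadratureKernel w n c (γ s) :=
    (continuousOn_quadratureKernel hw).comp_continuous hγ.continuous hγΩ
  have h_int : ∀ b ∈ Icc t (t + δ), ∫ s in t..b, g s = 0 := by
    intro b hb
    have hsub : Icc t b ⊆ Icc (t - δ) (t + δ) := Icc_subset_Icc (by linarith) hb.2
    set ν : Measure ℂ := (volume.restrict (Ioc t b)).map γ with hνdef
    have hγm : Measurable γ := hγ.continuous.measurable
    have hνfin : IsFiniteMeasure ν := Measure.isFiniteMeasure_map _ _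
    have hν : ∀ᵐ ζ ∂ν, ζ ∉ Ω := by
      rw [hνdef, ae_map_iff hγm.aemeasurable hΩ.measurableSet.compl]
      exact ae_of_all _ hγΩ
    have hpot : ∃ M : ℝ≥0∞, M ≠ ⊤ ∧
        ∀ z, ∫⁻ ζ, ENNReal.ofReal (‖z - ζ‖ ^ (-(1 / 2) : ℝ)) ∂ν ≤ M := by
      obtain ⟨M, hM, hle⟩ := exists_lintegral_norm_sub_rpow_le hb.1 hm hγ.continuous.continuousOn
        fun s hs s' hs' => hlow s (hsub hs) s' (hsub hs')
      refine ⟨M, hM, fun z => ?_⟩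
      rw [hνdef, lintegral_map (by fun_prop) hγm]
      exact hle z
    have h := integral_areaCauchy_eq_integral_quadratureKernel hΩ hA hw hq hν hpot
    have hkm : Measurable (quadratureKernel w n c) := by
      unfold quadratureKernel
      fun_prop
    rw [hνdef, integral_map hγm.aemeasurable (continuous_areaCauchy hA).aestronglyMeasurable,
      integral_map hγm.aemeasurable hkm.aestronglyMeasurable] at h
    rw [hg, intervalIntegral.integral_sub (hc1.intervalIntegrable _ _)
      (hc2.intervalIntegrable _ _), intervalIntegral.integral_of_le hb.1,
      intervalIntegral.integral_of_le hb.1, h, sub_self]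
  have hd : HasDerivWithinAt (fun b => ∫ s in t..b, g s) (g t) (Ici t) t :=
    ((hc1.sub hc2).integral_hasStrictDerivAt t t).hasDerivAt.hasDerivWithinAt
  have hd0 : HasDerivWithinAt (fun b => ∫ s in t..b, g s) 0 (Ici t) t := by
    refine (hasDerivWithinAt_const t (Ici t) (0 : ℂ)).congr_of_eventuallyEq ?_ (by simp)
    filter_upwards [Icc_mem_nhdsGE (show t < t + δ by linarith)] with b hb using h_int b hb
  exact sub_eq_zero.1 ((uniqueDiffWithinAt_Ici t).eq_deriv _ hd hd0)

end Quadrature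

end CauchyTransform

/-- After multiplication by finitely many linear factors with zeros in `Ω`, the function `f` agrees
off `Ω` with a function holomorphic in `Ω` and continuous up to the boundary. -/
def HasPolesIn (Ω : Set ℂ) (f : ℂ → ℂ) : Prop :=
  ∃ L : List ℂ, (∀ w ∈ L, w ∈ Ω) ∧ ∃ p : ℂ → ℂ, DiffContOnCl ℂ p Ω ∧
    ∀ z ∉ Ω, (L.map fun w => z - w).prod * f z = p z

lemma HasPolesIn.zero (Ω : Set ℂ) : HasPolesIn Ω fun _ => 0 :=
  ⟨[], by simp, fun _ => 0, diffContOnCl_const, by simp⟩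

lemma HasPolesIn.add {Ω : Set ℂ} {f g : ℂ → ℂ} (hf : HasPolesIn Ω f) (hg : HasPolesIn Ω g) :
    HasPolesIn Ω fun z => f z + g z := by
  obtain ⟨L, hL, p, hp, hpf⟩ := hf
  obtain ⟨L', hL', p', hp', hpg⟩ := hg
  refine ⟨L ++ L', fun w hw => (List.mem_append.1 hw).elim (hL w) (hL' w),
    fun z => (L'.map fun w => z - w).prod * p z + (L.map fun w => z - w).prod * p' z,
    ((DiffContOnCl.list_prod_sub L' Ω).mul' hp).add ((DiffContOnCl.list_prod_sub L Ω).mul' hp'),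
    fun z hz => ?_⟩
  beta_reduce
  rw [← hpf z hz, ← hpg z hz, List.map_append, List.prod_append]
  ring

lemma HasPolesIn.sum {Ω : Set ℂ} {ι : Type*} (s : Finset ι) {f : ι → ℂ → ℂ}
    (hf : ∀ i ∈ s, HasPolesIn Ω (f i)) : HasPolesIn Ω fun z => ∑ i ∈ s, f i z := by
  induction s using Finset.cons_induction with
  | empty => simpa using HasPolesIn.zero Ω
  | cons i s hi ih =>
    simp only [Finset.sum_cons]
    exact (hf i (Finset.mem_cons_self i s)).add
      (ih fun j hj => hf j (Finset.mem_cons_of_mem hj))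

lemma HasPolesIn.const_mul_inv_pow {Ω : Set ℂ} {w : ℂ} (hw : w ∈ Ω) (c : ℂ) (k : ℕ) :
    HasPolesIn Ω fun z => c * (w - z)⁻¹ ^ k := by
  refine ⟨List.replicate k w, fun x hx => (List.eq_of_mem_replicate hx) ▸ hw,
    fun _ => (-1) ^ k * c, diffContOnCl_const, fun z hz => ?_⟩
  have h : w - z ≠ 0 := sub_ne_zero.2 fun h => hz (h ▸ hw)
  rw [List.map_replicate, List.prod_replicate, mul_left_comm, ← mul_pow,
    show (z - w) * (w - z)⁻¹ = -1 by rw [← neg_sub w z, neg_mul, mul_inv_cancel₀ h], mul_comm]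

lemma hasPolesIn_quadratureKernel {Ω : Set ℂ} {N : ℕ} {w : Fin N → ℂ} (hw : ∀ j, w j ∈ Ω)
    (n : Fin N → ℕ) (c : Fin N → ℕ → ℂ) : HasPolesIn Ω (quadratureKernel w n c) := by
  unfold quadratureKernel
  refine HasPolesIn.sum _ fun j _ => HasPolesIn.sum _ fun k _ => ?_
  simp_rw [← mul_assoc]
  exact HasPolesIn.const_mul_inv_pow (hw j) _ _

/-- The boundary of a smoothly bounded quadrature domain is contained in a real algebraic curve. -/
lemma exists_polynomial_vanishing_of_isQuadratureDomain {Ω : Set ℂ} (hΩ : IsOpen Ω)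
    (hc : IsConnected Ω) (hA : volume Ω < ⊤) (hsm : HasSmoothBoundary Ω)
    (hq : IsQuadratureDomain Ω) :
    ∃ F : MvPolynomial (Fin 2) ℝ, F ≠ 0 ∧
      ∀ z ∈ frontier Ω, MvPolynomial.eval ![z.re, z.im] F = 0 := by
  obtain ⟨hb, m, γ, hγ, -, -, hγ', -, hfr⟩ := hsm
  obtain ⟨N, -, w, n, c, hw, hq⟩ := hq
  have hout : ∀ z ∈ frontier Ω, z ∉ Ω := fun z hz => by
    rw [hΩ.frontier_eq] at hz
    exact hz.2
  have hR : ∀ z ∈ frontier Ω, areaCauchy Ω z = quadratureKernel w n c z := by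
    intro z hz
    rw [hfr] at hz
    obtain ⟨i, t, rfl⟩ := mem_iUnion.1 hz
    refine areaCauchy_eq_quadratureKernel hΩ hA hw hq ((hγ i).of_le (by exact_mod_cast le_top))
      (fun s => hout _ ?_) (hγ' i t)
    rw [hfr]
    exact mem_iUnion.2 ⟨i, mem_range_self s⟩
  obtain ⟨L, hL, p, hp, hpR⟩ := hasPolesIn_quadratureKernel hw n c
  have hS : DiffContOnCl ℂ (fun z => conj z + areaCauchy Ω z / Real.pi) Ω :=
    ⟨differentiableOn_conj_add_areaCauchy hΩ hA,
      (Complex.continuous_conj.add ((continuous_areaCauchy hA).div_const _)).continuousOn⟩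
  refine exists_polynomial_vanishing_on_frontier hΩ hc hb L hL
    (((DiffContOnCl.list_prod_sub L Ω).mul' hS).sub (hp.const_smul (Real.pi : ℂ)⁻¹))
    fun z hz => ?_
  simp only [Pi.sub_apply, Pi.smul_apply, smul_eq_mul]
  rw [← hpR z (hout z hz), hR z hz]
  ring

/-- for a smoothly bounded quadrature domain of finite area, the square of the
unit tangent vector function on the boundary is a rational function of `z` and `conj z`. -/
theorem stmt_10 (Ω : Set ℂ) (hΩ : IsFinConnDomain Ω) (hA : volume Ω < ⊤)
    (hsm : HasSmoothBoundary Ω) (hq : IsQuadratureDomain Ω) :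
    ∃ P Q : MvPolynomial (Fin 2) ℂ,
      (∃ z ∈ frontier Ω, MvPolynomial.eval ![z, conj z] Q ≠ 0) ∧
      ∀ (a b : ℝ) (γ : ℝ → ℂ), ContDiffOn ℝ 1 γ (Ioo a b) →
        (∀ t ∈ Ioo a b, γ t ∈ frontier Ω) →
        (∀ t ∈ Ioo a b, deriv γ t ≠ 0) →
        ∀ t ∈ Ioo a b,
          (deriv γ t / (‖deriv γ t‖ : ℂ)) ^ 2 *
              MvPolynomial.eval ![γ t, conj (γ t)] Q =
            MvPolynomial.eval ![γ t, conj (γ t)] P := by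
  obtain ⟨hopen, hconn, -, -⟩ := hΩ
  have hne : (frontier Ω).Nonempty := by
    refine nonempty_frontier_iff.2 ⟨hconn.nonempty, fun h => ?_⟩
    exact NormedSpace.unbounded_univ ℝ ℂ (h ▸ hsm.1)
  exact exists_tangent_sq_rational hne
    (exists_polynomial_vanishing_of_isQuadratureDomain hopen hconn hA hsm hq)
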